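/- arXiv:math/0104256 — 3 statements merged into one kernel-verified Lean document; each statement's English description precedes it below -/
import Mathlib

section
/- Let r and N be positive integers with N ≥ 6r, and let C be an additive subgroup (a binary linear code) of (ℤ/2ℤ)^N such that every element c of C satisfies either wt(c) ≤ 2r or wt(c) ≥ N − 2r + 2. If C is generated as a group by a set of elements each of Hamming weight at most 2r, then every element of C has Hamming weight at most 2r. -/
theorem hammingNorm_neg {ι : Type*} [Fintype ι] {β : ι → Type*} [∀ i, DecidableEq (β i)]
    [∀ i, AddGroup (β i)] (x : ∀ i, β i) : hammingNorm (-x) = hammingNorm x := by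
  simp [hammingNorm]

theorem hammingNorm_add_le {ι : Type*} [Fintype ι] {β : ι → Type*} [∀ i, DecidableEq (β i)]
    [∀ i, AddGroup (β i)] (x y : ∀ i, β i) :
    hammingNorm (x + y) ≤ hammingNorm x + hammingNorm y := by
  have h := hammingDist_triangle (-x) 0 y
  rwa [hammingDist_eq_hammingNorm, neg_neg, hammingDist_zero_right, hammingDist_zero_left,
    hammingNorm_neg] at h

/-- From the proof of the Main Lemma: in a binary linear code `C ⊆ (ℤ/2ℤ)^N` with `N ≥ 6r`
in which every codeword has weight `≤ 2r` or weight `≥ N - 2r + 2`, if `C` is generated by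
elements of weight `≤ 2r` then every codeword has weight `≤ 2r`. -/
theorem code_generated_small_weight
    (r N : ℕ) (hr : 0 < r) (hN0 : 0 < N) (hN : 6 * r ≤ N)
    (C : AddSubgroup (Fin N → ZMod 2))
    (hC : ∀ c ∈ C, hammingNorm c ≤ 2 * r ∨ N - 2 * r + 2 ≤ hammingNorm c)
    (S : Set (Fin N → ZMod 2)) (hgen : C = AddSubgroup.closure S)
    (hS : ∀ s ∈ S, hammingNorm s ≤ 2 * r) :
    ∀ c ∈ C, hammingNorm c ≤ 2 * r := by
  subst hgen
  intro c hc
  induction hc using AddSubgroup.closure_induction with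
  | mem x hx => exact hS x hx
  | zero => simp
  | add x y hx hy ihx ihy =>
    have hxy := hC (x + y) (add_mem hx hy)
    have hle := hammingNorm_add_le x y
    omega
  | neg x _ ih => rwa [hammingNorm_neg]
end

section
/- Let r and m be positive integers. For each i ∈ {1, …, 2r} let σ_i be an element of (ℤ/2ℤ)^{2r} × (ℤ/2ℤ)^{m} whose first component is the i-th standard basis vector of (ℤ/2ℤ)^{2r} (i.e., the j-th coordinate of the first component of σ_i equals 1 if j = i and 0 otherwise). Suppose that for every subset S ⊆ {1, …, 2r}, the sum Σ_{i ∈ S} σ_i has total Hamming weight at most 2r. Then: (i) the second component of Σ_{i=1}^{2r} σ_i is zero, i.e., for each of the m extra coordinates, the number of indices i for which σ_i has a 1 in that coordinate is even; and (ii) each σ_i has total Hamming weight at most 2, i.e., the second component of each σ_i has Hamming weight at most 1. -/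
theorem hammingNorm_sum_single_one {ι R : Type*} [Fintype ι] [DecidableEq ι] [Semiring R]
    [Nontrivial R] [DecidableEq R] (S : Finset ι) :
    hammingNorm (∑ i ∈ S, (Pi.single i 1 : ι → R)) = S.card := by
  simp [hammingNorm, Finset.sum_apply, Pi.single_apply]

/-- Combinatorial content of Claim 5.3 (1) and (2) in the paper: given elements
`σ₁, …, σ_{2r}` of `(ℤ/2ℤ)^{2r} × (ℤ/2ℤ)^m` whose first components are the standard basis
vectors, if every subset-sum of the `σ_i` has total Hamming weight at most `2r`, then the
second component of the full sum `Σ σ_i` vanishes (each extra coordinate is hit an even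
number of times), and each `σ_i` has total Hamming weight at most `2` (second component of
weight at most `1`). -/
theorem involutions_weight_two
    (r m : ℕ) (hr : 0 < r) (hm : 0 < m)
    (σ : Fin (2 * r) → (Fin (2 * r) → ZMod 2) × (Fin m → ZMod 2))
    (hbasis : ∀ i, (σ i).1 = Pi.single i 1)
    (hwt : ∀ S : Finset (Fin (2 * r)),
      hammingNorm (∑ i ∈ S, σ i).1 + hammingNorm (∑ i ∈ S, σ i).2 ≤ 2 * r) :
    (∑ i : Fin (2 * r), σ i).2 = 0 ∧
    (∀ i : Fin (2 * r),
      hammingNorm (σ i).1 + hammingNorm (σ i).2 ≤ 2 ∧ hammingNorm (σ i).2 ≤ 1) := by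
  have hcard (S : Finset (Fin (2 * r))) :
      S.card + hammingNorm (∑ i ∈ S, σ i).2 ≤ 2 * r := by
    have h := hwt S
    rwa [Prod.fst_sum, Finset.sum_congr rfl fun i _ => hbasis i,
      hammingNorm_sum_single_one] at h
  have hzero : (∑ i : Fin (2 * r), σ i).2 = 0 := by
    have h := hcard Finset.univ
    rw [Finset.card_univ, Fintype.card_fin] at h
    exact hammingNorm_eq_zero.mp (by omega)
  refine ⟨hzero, fun i => ?_⟩
  have hcompl : (∑ j ∈ Finset.univ.erase i, σ j).2 = (σ i).2 := by
    rw [← Finset.add_sum_erase _ _ (Finset.mem_univ i), Prod.snd_add] at hzero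
    rw [← neg_eq_of_add_eq_zero_right hzero]
    exact funext fun j => ZMod.neg_eq_self_mod_two _
  have hsnd : hammingNorm (σ i).2 ≤ 1 := by
    have h := hcard (Finset.univ.erase i)
    rw [hcompl, Finset.card_erase_of_mem (Finset.mem_univ i), Finset.card_univ,
      Fintype.card_fin] at h
    omega
  have hfst : hammingNorm (σ i).1 = 1 := by
    simpa [hbasis i] using hammingNorm_sum_single_one (R := ZMod 2) {i}
  exact ⟨by omega, hsnd⟩
end

section
/- Let r and m be positive integers. For each i ∈ {1, …, 2r} let σ_i be an element of (ℤ/2ℤ)^{2r} × (ℤ/2ℤ)^{m} whose first component is the i-th standard basis vector of (ℤ/2ℤ)^{2r}. Suppose that for every subset S ⊆ {1, …, 2r}, the sum Σ_{i ∈ S} σ_i has total Hamming weight at most 2r. Then the number of extra coordinates j ∈ {1, …, m} such that some σ_i has a 1 in coordinate j of its second component is at most r. -/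
/-- A sum of distinct standard basis vectors has Hamming weight the number of summands. -/
theorem hammingNorm_sum_single {ι : Type*} [Fintype ι] [DecidableEq ι] (S : Finset ι) :
    hammingNorm (∑ i ∈ S, (Pi.single i 1 : ι → ZMod 2)) = S.card := by
  unfold hammingNorm
  congr 1
  ext j
  simp [Finset.sum_apply, Pi.single_apply]

/-- A family of scalars with zero sum and a nonzero member has at least two nonzero members. -/
theorem two_le_card_ne_zero_of_sum_eq_zero {ι M : Type*} [Fintype ι] [AddCommMonoid M]
    [DecidableEq M] {f : ι → M} (hsum : ∑ i, f i = 0) {i : ι} (hi : f i ≠ 0) :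
    2 ≤ (Finset.univ.filter fun k => f k ≠ 0).card := by
  by_contra! h
  refine hi ?_
  rw [← hsum]
  refine (Finset.sum_eq_single i (fun k _ hk => ?_) (by simp)).symm
  by_contra hk0
  exact hk (Finset.card_le_one.mp (Nat.lt_succ_iff.mp h) k (by simpa using hk0) i
    (by simpa using hi))

/-- Combinatorial content of Claim 5.3 (3) in the paper: given elements `σ₁, …, σ_{2r}` of
`(ℤ/2ℤ)^{2r} × (ℤ/2ℤ)^m` whose first components are the standard basis vectors, if every
subset-sum of the `σ_i` has total Hamming weight at most `2r`, then at most `r` of the `m`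
extra coordinates are nonzero for some `σ_i` (the 2-torus acts non-trivially on at most `r`
of the representation spaces `R_{2r+1}, …, R_{2k}`). -/
theorem two_torus_nontrivial_columns
    (r m : ℕ) (hr : 0 < r) (hm : 0 < m)
    (σ : Fin (2 * r) → (Fin (2 * r) → ZMod 2) × (Fin m → ZMod 2))
    (hbasis : ∀ i, (σ i).1 = Pi.single i 1)
    (hwt : ∀ S : Finset (Fin (2 * r)),
      hammingNorm (∑ i ∈ S, σ i).1 + hammingNorm (∑ i ∈ S, σ i).2 ≤ 2 * r) :
    Set.ncard {j : Fin m | ∃ i : Fin (2 * r), (σ i).2 j ≠ 0} ≤ r := by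
  have hwt' : ∀ S : Finset (Fin (2 * r)),
      S.card + hammingNorm (∑ i ∈ S, (σ i).2) ≤ 2 * r := by
    intro S
    simpa only [Prod.fst_sum, Prod.snd_sum, hbasis, hammingNorm_sum_single] using hwt S
  have hsum : ∑ i, (σ i).2 = 0 := by
    have h := hwt' Finset.univ
    rw [Finset.card_univ, Fintype.card_fin] at h
    exact hammingNorm_eq_zero.mp (by omega)
  have hrow : ∀ i, hammingNorm (σ i).2 ≤ 1 := by
    intro i
    have h := hwt' (Finset.univ.erase i)
    have hneg : ∑ k ∈ Finset.univ.erase i, (σ k).2 = (σ i).2 := by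
      have h0 := Finset.sum_erase_add Finset.univ (fun k => (σ k).2) (Finset.mem_univ i)
      rw [hsum] at h0
      rw [eq_neg_of_add_eq_zero_left h0]
      ext j
      simp [ZMod.neg_eq_self_mod_two]
    rw [hneg, Finset.card_erase_of_mem (Finset.mem_univ i), Finset.card_univ,
      Fintype.card_fin] at h
    omega
  classical
  rw [Set.ncard_eq_toFinset_card']
  have hcount := Finset.card_mul_le_card_mul' (fun (i : Fin (2 * r)) (j : Fin m) => (σ i).2 j ≠ 0)
    (s := Finset.univ) (t := {j : Fin m | ∃ i, (σ i).2 j ≠ 0}.toFinset) (n := 2) (m := 1)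
    (fun j hj => by
      obtain ⟨i, hi⟩ := Set.mem_toFinset.mp hj
      exact two_le_card_ne_zero_of_sum_eq_zero (f := fun k => (σ k).2 j)
        (by simpa using congrFun hsum j) hi)
    (fun i _ => (Finset.card_le_card
      (Finset.filter_subset_filter _ (Finset.subset_univ _))).trans (hrow i))
  rw [Finset.card_univ, Fintype.card_fin] at hcount
  omega
end
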